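/- The number of triples (D, E, F) of nonzero octonions in O³ such that DE = EF = FD = 0 and Tr(x_1·D̄) = 0 equals (q^6 − q^3 + q^4 − 1)(q^4 − 1)(q^3 − 1). -/

import Mathlib

/-!  The split octonion algebra `O` over a finite field `F` of order `q`,
represented as `Fin 8 → F` with coordinates with respect to the basis
`x_1, …, x_8` (index `i : Fin 8` corresponds to `x_{i+1}`). -/

variable {F : Type*}

/-- The split octonion multiplication, determined by the table
`x_1x_5 = x_1`, `x_1x_6 = x_2`, `x_1x_7 = −x_3`, `x_1x_8 = −x_4`, `x_2x_3 = −x_1`,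
`x_2x_4 = x_2`, `x_2x_7 = −x_5`, `x_2x_8 = x_6`, `x_3x_2 = x_1`, `x_3x_4 = x_3`,
`x_3x_6 = −x_5`, `x_3x_8 = −x_7` (the sign of `x_3x_8` is forced by `x_8x_3 = x_7` and anti-commutativity of orthogonal imaginary octonions; with it `O` is the split octonion composition algebra), `x_4x_1 = x_1`, `x_4x_4 = x_4`, `x_4x_6 = x_6`,
`x_4x_7 = x_7`, `x_5x_2 = x_2`, `x_5x_3 = x_3`, `x_5x_5 = x_5`, `x_5x_8 = x_8`,
`x_6x_1 = −x_2`, `x_6x_3 = −x_4`, `x_6x_5 = x_6`, `x_6x_7 = x_8`, `x_7x_1 = x_3`,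
`x_7x_2 = −x_4`, `x_7x_5 = x_7`, `x_7x_6 = −x_8`, `x_8x_1 = −x_5`, `x_8x_2 = −x_6`,
`x_8x_3 = x_7`, `x_8x_4 = x_8`, all other products of basis elements being `0`. -/
def octMul [Field F] (a b : Fin 8 → F) : Fin 8 → F :=
  ![a 0 * b 4 - a 1 * b 2 + a 2 * b 1 + a 3 * b 0,
    a 0 * b 5 + a 1 * b 3 + a 4 * b 1 - a 5 * b 0,
    -(a 0 * b 6) + a 2 * b 3 + a 4 * b 2 + a 6 * b 0,
    -(a 0 * b 7) + a 3 * b 3 - a 5 * b 2 - a 6 * b 1,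
    -(a 1 * b 6) - a 2 * b 5 + a 4 * b 4 - a 7 * b 0,
    a 1 * b 7 + a 3 * b 5 + a 5 * b 4 - a 7 * b 1,
    -(a 2 * b 7) + a 3 * b 6 + a 6 * b 4 + a 7 * b 2,
    a 4 * b 7 + a 5 * b 6 - a 6 * b 5 + a 7 * b 3]

/-- The identity `1 = x_4 + x_5` of the octonion algebra. -/
def octOne [Field F] : Fin 8 → F := ![0, 0, 0, 1, 1, 0, 0, 0]

/-- Octonion conjugation: swaps `x_4, x_5` and negates the other basis vectors. -/
def octConj [Field F] (a : Fin 8 → F) : Fin 8 → F :=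
  ![-a 0, -a 1, -a 2, a 4, a 3, -a 5, -a 6, -a 7]

/-- The trace `Tr(Σ λ_i x_i) = λ_4 + λ_5`. -/
def octTr [Field F] (a : Fin 8 → F) : F := a 3 + a 4

/-- The norm `N(Σ λ_i x_i) = λ_1λ_8 + λ_2λ_7 + λ_3λ_6 + λ_4λ_5`. -/
def octN [Field F] (a : Fin 8 → F) : F :=
  a 0 * a 7 + a 1 * a 6 + a 2 * a 5 + a 3 * a 4

/-- The bilinear form `B(x,y) = N(x+y) − N(x) − N(y)`. -/
def octB [Field F] (a b : Fin 8 → F) : F := octN (a + b) - octN a - octN b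

/-- The basis octonion `x_1`. -/
def octX1 [Field F] : Fin 8 → F := ![1, 0, 0, 0, 0, 0, 0, 0]

section Counting

variable {F : Type*} [Field F] [Fintype F]

/-- A nonzero vector is orthogonal to exactly `q ^ n` vectors of `F ^ (n + 1)`. -/
theorem natCard_dotProduct_eq_zero {n : ℕ} {e : Fin (n + 1) → F} (he : e ≠ 0) :
    Nat.card {f : Fin (n + 1) → F // e ⬝ᵥ f = 0} = Fintype.card F ^ n := by
  let φ : Module.Dual F (Fin (n + 1) → F) := dotProductBilin F F e
  have hφ : φ ≠ 0 := by
    intro h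
    exact he (dotProduct_eq_zero e fun w => LinearMap.congr_fun h w)
  have h1 := Module.Dual.finrank_ker_add_one_of_ne_zero hφ
  rw [Module.finrank_fin_fun] at h1
  have h2 : Nat.card (LinearMap.ker φ) = Fintype.card F ^ n := by
    rw [Module.natCard_eq_pow_finrank (K := F), Nat.card_eq_fintype_card]
    congr 1
    omega
  rw [← h2]
  exact Nat.card_congr (Equiv.subtypeEquivRight fun f => by simp [φ])

theorem natCard_ne_zero_and {V : Type*} [Zero V] [Finite V] (p : V → Prop) (h0 : p 0) :
    Nat.card {v : V // v ≠ 0 ∧ p v} = Nat.card {v : V // p v} - 1 := by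
  have h := Set.ncard_sdiff_singleton_of_mem (s := {v | p v}) (a := 0) h0
  rw [← Nat.card_coe_set_eq, ← Nat.card_coe_set_eq] at h
  rw [← Nat.card_congr (Equiv.refl {v : V // p v})]
  refine Eq.trans (Nat.card_congr (Equiv.subtypeEquivRight fun v => ?_)) h
  simp [and_comm]

theorem natCard_pi_ne_zero (n : ℕ) :
    Nat.card {v : Fin n → F // v ≠ 0} = Fintype.card F ^ n - 1 := by
  have h := natCard_ne_zero_and (V := Fin n → F) (fun _ => True) trivial
  simpa using h

/-- Fibrewise counting of pairs when all the fibres have the same size. -/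
theorem natCard_prod_of_fiber {α β : Type*} [Finite α] [Finite β] {p : α → Prop}
    {r : α → β → Prop} {m : ℕ} (h : ∀ a, p a → Nat.card {b // r a b} = m) :
    Nat.card {t : α × β // p t.1 ∧ r t.1 t.2} = Nat.card {a // p a} * m := by
  have := Fintype.ofFinite {a // p a}
  let e : {t : α × β // p t.1 ∧ r t.1 t.2} ≃ (Σ a : {a // p a}, {b // r a.1 b}) :=
    { toFun := fun t => ⟨⟨t.1.1, t.2.1⟩, ⟨t.1.2, t.2.2⟩⟩
      invFun := fun s => ⟨(s.1.1, s.2.1), s.1.2, s.2.2⟩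
      left_inv := fun _ => rfl
      right_inv := fun _ => rfl }
  rw [Nat.card_congr e, Nat.card_sigma, Finset.sum_congr rfl fun a _ => h a.1 a.2]
  simp

theorem natCard_orthogonal_pairs_ne_zero (n : ℕ) :
    Nat.card {t : (Fin (n + 1) → F) × (Fin (n + 1) → F) //
      t.1 ≠ 0 ∧ t.2 ≠ 0 ∧ t.1 ⬝ᵥ t.2 = 0} =
      (Fintype.card F ^ (n + 1) - 1) * (Fintype.card F ^ n - 1) := by
  rw [natCard_prod_of_fiber (p := fun e : Fin (n + 1) → F => e ≠ 0)
    (r := fun e f : Fin (n + 1) → F => f ≠ 0 ∧ e ⬝ᵥ f = 0) (m := Fintype.card F ^ n - 1),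
    natCard_pi_ne_zero]
  intro e he
  rw [natCard_ne_zero_and (fun f => e ⬝ᵥ f = 0) (dotProduct_zero e), natCard_dotProduct_eq_zero he]

theorem natCard_orthogonal_pairs (n : ℕ) :
    Nat.card {t : (Fin (n + 1) → F) × (Fin (n + 1) → F) // t.1 ⬝ᵥ t.2 = 0} =
      (Fintype.card F ^ (n + 1) - 1) * Fintype.card F ^ n + Fintype.card F ^ (n + 1) := by
  classical
  have h1 := natCard_prod_of_fiber (p := fun e : Fin (n + 1) → F => e ≠ 0)
    (r := fun e f : Fin (n + 1) → F => e ⬝ᵥ f = 0) (m := Fintype.card F ^ n)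
    fun e he => natCard_dotProduct_eq_zero he
  have h2 := natCard_prod_of_fiber (p := fun e : Fin (n + 1) → F => e = 0)
    (r := fun e f : Fin (n + 1) → F => e ⬝ᵥ f = 0) (m := Fintype.card F ^ (n + 1)) (by
      rintro e rfl
      simp)
  rw [natCard_pi_ne_zero] at h1
  rw [show Nat.card {e : Fin (n + 1) → F // e = 0} = 1 from Nat.card_unique, one_mul] at h2
  rw [← h1, ← h2, ← Nat.card_sum]
  let p : (Fin (n + 1) → F) × (Fin (n + 1) → F) → Prop := fun t => t.1 ⬝ᵥ t.2 = 0
  let r : (Fin (n + 1) → F) × (Fin (n + 1) → F) → Prop := fun t => t.1 ≠ 0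
  refine Nat.card_congr ((Equiv.sumCompl fun t : {t // p t} => r t).symm.trans
    (Equiv.sumCongr ?_ ?_))
  · exact (Equiv.subtypeSubtypeEquivSubtypeInter p r).trans
      (Equiv.subtypeEquivRight fun _ => and_comm)
  · exact (Equiv.subtypeSubtypeEquivSubtypeInter p fun t => ¬r t).trans
      (Equiv.subtypeEquivRight fun t => by simp [p, r, and_comm])

end Counting

section Octonion

variable {F : Type*} [Field F]

theorem octMul_moufang_middle (u a b : Fin 8 → F) :
    octMul (octMul u a) (octMul b u) = octMul (octMul u (octMul a b)) u := by
  ext i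
  fin_cases i <;> simp [octMul] <;> ring

theorem octMul_moufang_right (u a b : Fin 8 → F) :
    octMul (octMul (octMul a u) b) u = octMul a (octMul (octMul u b) u) := by
  ext i
  fin_cases i <;> simp [octMul] <;> ring

theorem octMul_moufang_left (u a b : Fin 8 → F) :
    octMul u (octMul a (octMul u b)) = octMul (octMul (octMul u a) u) b := by
  ext i
  fin_cases i <;> simp [octMul] <;> ring

theorem octMul_conj_cancel_left (u a : Fin 8 → F) :
    octMul (octConj u) (octMul u a) = octN u • a := by
  ext i
  fin_cases i <;> simp [octMul, octConj, octN] <;> ring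

theorem octMul_conj_cancel_right (u a : Fin 8 → F) :
    octMul (octMul a u) (octConj u) = octN u • a := by
  ext i
  fin_cases i <;> simp [octMul, octConj, octN] <;> ring

theorem octN_octMul (a b : Fin 8 → F) : octN (octMul a b) = octN a * octN b := by
  simp [octMul, octN]
  ring

theorem octN_octConj (a : Fin 8 → F) : octN (octConj a) = octN a := by
  simp [octConj, octN]
  ring

theorem octConj_octConj (a : Fin 8 → F) : octConj (octConj a) = a := by
  ext i
  fin_cases i <;> simp [octConj]

theorem octConj_octMul (a b : Fin 8 → F) :
    octConj (octMul a b) = octMul (octConj b) (octConj a) := by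
  ext i
  fin_cases i <;> simp [octMul, octConj] <;> ring

theorem octMul_zero (a : Fin 8 → F) : octMul a 0 = 0 := by
  ext i
  fin_cases i <;> simp [octMul]

theorem zero_octMul (a : Fin 8 → F) : octMul 0 a = 0 := by
  ext i
  fin_cases i <;> simp [octMul]

theorem octConj_eq_zero {a : Fin 8 → F} : octConj a = 0 ↔ a = 0 := by
  have h : octConj (0 : Fin 8 → F) = 0 := by
    ext i
    fin_cases i <;> simp [octConj]
  constructor
  · intro ha
    rw [← octConj_octConj a, ha, h]
  · rintro rfl
    exact h

theorem octMul_sub (a b c : Fin 8 → F) : octMul a (b - c) = octMul a b - octMul a c := by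
  ext i
  fin_cases i <;> simp [octMul] <;> ring

theorem sub_octMul (a b c : Fin 8 → F) : octMul (a - b) c = octMul a c - octMul b c := by
  ext i
  fin_cases i <;> simp [octMul] <;> ring

theorem octMul_eq_zero_iff_right {u a : Fin 8 → F} (hu : octN u ≠ 0) :
    octMul u a = 0 ↔ a = 0 := by
  refine ⟨fun h => ?_, by rintro rfl; exact octMul_zero u⟩
  have := octMul_conj_cancel_left u a
  rw [h, octMul_zero] at this
  exact (smul_eq_zero.mp this.symm).resolve_left hu

theorem octMul_eq_zero_iff_left {u a : Fin 8 → F} (hu : octN u ≠ 0) :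
    octMul a u = 0 ↔ a = 0 := by
  refine ⟨fun h => ?_, by rintro rfl; exact zero_octMul u⟩
  have := octMul_conj_cancel_right u a
  rw [h, zero_octMul] at this
  exact (smul_eq_zero.mp this.symm).resolve_left hu

theorem octN_eq_zero_of_octMul_eq_zero {a b : Fin 8 → F} (hb : b ≠ 0) (h : octMul a b = 0) :
    octN a = 0 := by
  by_contra ha
  exact hb ((octMul_eq_zero_iff_right ha).mp h)

/-- The pairs `(E, G)` completing `D` to a triple with `DE = EG = GD = 0`. -/
def IsCompletion (D : Fin 8 → F) (t : (Fin 8 → F) × (Fin 8 → F)) : Prop :=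
  t.1 ≠ 0 ∧ t.2 ≠ 0 ∧ octMul D t.1 = 0 ∧ octMul t.1 t.2 = 0 ∧ octMul t.2 D = 0

theorem isCompletion_octMul_iff {u D E G : Fin 8 → F} (hu : octN u ≠ 0) :
    IsCompletion D (E, octMul (octMul u G) u) ↔ IsCompletion (octMul u D) (octMul E u, G) := by
  simp only [IsCompletion, ne_eq, octMul_moufang_middle, octMul_eq_zero_iff_left hu,
    octMul_eq_zero_iff_right hu, ← octMul_moufang_right, ← octMul_moufang_left]

theorem natCard_isCompletion_octMul [Finite F] {u : Fin 8 → F} (hu : octN u ≠ 0)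
    (D : Fin 8 → F) :
    Nat.card {t // IsCompletion (octMul u D) t} = Nat.card {t // IsCompletion D t} := by
  have hR : Function.Injective fun E : Fin 8 → F => octMul E u := by
    intro a b h
    rw [← sub_eq_zero, ← octMul_eq_zero_iff_left hu, sub_octMul]
    exact sub_eq_zero.mpr h
  have hL : Function.Injective fun E : Fin 8 → F => octMul u E := by
    intro a b h
    rw [← sub_eq_zero, ← octMul_eq_zero_iff_right hu, octMul_sub]
    exact sub_eq_zero.mpr h
  let ρ : (Fin 8 → F) ≃ (Fin 8 → F) := Equiv.ofBijective _ (Finite.injective_iff_bijective.mp hR)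
  let ν : (Fin 8 → F) ≃ (Fin 8 → F) :=
    Equiv.ofBijective _ (Finite.injective_iff_bijective.mp (hR.comp hL))
  let p : (Fin 8 → F) × (Fin 8 → F) → Prop :=
    fun t => IsCompletion D (t.1, octMul (octMul u t.2) u)
  have e₁ : {t // p t} ≃ {t // IsCompletion (octMul u D) t} :=
    (ρ.prodCongr (Equiv.refl _)).subtypeEquiv fun _ => isCompletion_octMul_iff hu
  have e₂ : {t // p t} ≃ {t // IsCompletion D t} :=
    ((Equiv.refl _).prodCongr ν).subtypeEquiv fun _ => Iff.rfl
  exact Nat.card_congr (e₁.symm.trans e₂)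

theorem natCard_isCompletion_octConj (D : Fin 8 → F) :
    Nat.card {t // IsCompletion (octConj D) t} = Nat.card {t // IsCompletion D t} := by
  let κ : (Fin 8 → F) ≃ (Fin 8 → F) := ⟨octConj, octConj, octConj_octConj, octConj_octConj⟩
  refine (Nat.card_congr (((Equiv.prodComm _ _).trans (κ.prodCongr κ)).subtypeEquiv ?_)).symm
  rintro ⟨E, G⟩
  simp only [IsCompletion, κ, Equiv.trans_apply, Equiv.prodComm_apply, Prod.swap_prod_mk,
    Equiv.prodCongr_apply, Prod.map_apply, Equiv.coe_fn_mk, ← octConj_octMul, octConj_eq_zero,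
    ne_eq]
  tauto

/-- Solves `D * E = 0` for `E` when the first coordinate of `D` does not vanish. -/
def rightAnnihilatorMap (D : Fin 8 → F) (e : Fin 4 → F) : Fin 8 → F :=
  ![e 0, e 1, e 2, e 3,
    (D 1 * e 2 - D 2 * e 1 - D 3 * e 0) / D 0,
    (D 5 * e 0 - D 1 * e 3 - D 4 * e 1) / D 0,
    (D 2 * e 3 + D 4 * e 2 + D 6 * e 0) / D 0,
    (D 3 * e 3 - D 5 * e 2 - D 6 * e 1) / D 0]

/-- Solves `G * D = 0` for `G` when the first coordinate of `D` does not vanish; the free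
coordinates are arranged so that `E * G = 0` becomes an orthogonality relation. -/
def leftAnnihilatorMap (D : Fin 8 → F) (g : Fin 4 → F) : Fin 8 → F :=
  ![g 3, g 2, -g 1,
    (g 2 * D 2 + g 1 * D 1 - g 3 * D 4) / D 0,
    g 0,
    (g 3 * D 5 + g 2 * D 3 + g 0 * D 1) / D 0,
    (g 3 * D 6 + g 1 * D 3 - g 0 * D 2) / D 0,
    (g 0 * D 4 - g 2 * D 6 + g 1 * D 5) / D 0]

theorem octMul_rightAnnihilatorMap {D : Fin 8 → F} (h0 : D 0 ≠ 0) (hN : octN D = 0)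
    (e : Fin 4 → F) : octMul D (rightAnnihilatorMap D e) = 0 := by
  have h7 : D 7 = -(D 1 * D 6 + D 2 * D 5 + D 3 * D 4) / D 0 := by
    rw [eq_div_iff h0]
    simp only [octN] at hN
    linear_combination hN
  ext i
  fin_cases i <;> simp [octMul, rightAnnihilatorMap, h7] <;> field_simp <;> ring

theorem leftAnnihilatorMap_octMul {D : Fin 8 → F} (h0 : D 0 ≠ 0) (hN : octN D = 0)
    (g : Fin 4 → F) : octMul (leftAnnihilatorMap D g) D = 0 := by
  have h7 : D 7 = -(D 1 * D 6 + D 2 * D 5 + D 3 * D 4) / D 0 := by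
    rw [eq_div_iff h0]
    simp only [octN] at hN
    linear_combination hN
  ext i
  fin_cases i <;> simp [octMul, leftAnnihilatorMap, h7] <;> field_simp <;> ring

theorem annihilatorMap_octMul {D : Fin 8 → F} (h0 : D 0 ≠ 0) (hN : octN D = 0)
    (e g : Fin 4 → F) :
    octMul (rightAnnihilatorMap D e) (leftAnnihilatorMap D g) = (-(e ⬝ᵥ g) / D 0) • octConj D := by
  have h7 : D 7 = -(D 1 * D 6 + D 2 * D 5 + D 3 * D 4) / D 0 := by
    rw [eq_div_iff h0]
    simp only [octN] at hN
    linear_combination hN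
  ext i
  fin_cases i <;>
    simp [octMul, rightAnnihilatorMap, leftAnnihilatorMap, h7, dotProduct, octConj,
      Fin.sum_univ_succ] <;>
    field_simp <;> ring

theorem eq_rightAnnihilatorMap {D E : Fin 8 → F} (h0 : D 0 ≠ 0) (h : octMul D E = 0) :
    rightAnnihilatorMap D ![E 0, E 1, E 2, E 3] = E := by
  have e0 := congrFun h 0
  have e1 := congrFun h 1
  have e2 := congrFun h 2
  have e3 := congrFun h 3
  simp [octMul] at e0 e1 e2 e3
  ext i
  fin_cases i <;> simp [rightAnnihilatorMap] <;> rw [div_eq_iff h0]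
  · linear_combination -e0
  · linear_combination -e1
  · linear_combination e2
  · linear_combination e3

theorem eq_leftAnnihilatorMap {D G : Fin 8 → F} (h0 : D 0 ≠ 0) (h : octMul G D = 0) :
    leftAnnihilatorMap D ![G 4, -G 2, G 1, G 0] = G := by
  have e0 := congrFun h 0
  have e1 := congrFun h 1
  have e2 := congrFun h 2
  have e4 := congrFun h 4
  simp [octMul] at e0 e1 e2 e4
  ext i
  fin_cases i <;> simp [leftAnnihilatorMap] <;> rw [div_eq_iff h0]
  · linear_combination -e0
  · linear_combination e1
  · linear_combination -e2
  · linear_combination e4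

theorem rightAnnihilatorMap_coords (D : Fin 8 → F) (e : Fin 4 → F) :
    ![rightAnnihilatorMap D e 0, rightAnnihilatorMap D e 1, rightAnnihilatorMap D e 2,
      rightAnnihilatorMap D e 3] = e := by
  ext i
  fin_cases i <;> simp [rightAnnihilatorMap]

theorem leftAnnihilatorMap_coords (D : Fin 8 → F) (g : Fin 4 → F) :
    ![leftAnnihilatorMap D g 4, -leftAnnihilatorMap D g 2, leftAnnihilatorMap D g 1,
      leftAnnihilatorMap D g 0] = g := by
  ext i
  fin_cases i <;> simp [leftAnnihilatorMap]

theorem rightAnnihilatorMap_eq_zero {D : Fin 8 → F} {e : Fin 4 → F} :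
    rightAnnihilatorMap D e = 0 ↔ e = 0 := by
  constructor
  · intro h
    rw [← rightAnnihilatorMap_coords D e, h]
    ext i
    fin_cases i <;> rfl
  · rintro rfl
    ext i
    fin_cases i <;> simp [rightAnnihilatorMap]

theorem leftAnnihilatorMap_eq_zero {D : Fin 8 → F} {g : Fin 4 → F} :
    leftAnnihilatorMap D g = 0 ↔ g = 0 := by
  constructor
  · intro h
    rw [← leftAnnihilatorMap_coords D g, h]
    ext i
    fin_cases i <;> simp
  · rintro rfl
    ext i
    fin_cases i <;> simp [leftAnnihilatorMap]

theorem isCompletion_annihilatorMap_iff {D : Fin 8 → F} (h0 : D 0 ≠ 0) (hN : octN D = 0)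
    (e g : Fin 4 → F) :
    IsCompletion D (rightAnnihilatorMap D e, leftAnnihilatorMap D g) ↔
      e ≠ 0 ∧ g ≠ 0 ∧ e ⬝ᵥ g = 0 := by
  have hD : D ≠ 0 := fun h => h0 (congrFun h 0)
  simp [IsCompletion, rightAnnihilatorMap_eq_zero, leftAnnihilatorMap_eq_zero,
    octMul_rightAnnihilatorMap h0 hN, leftAnnihilatorMap_octMul h0 hN,
    annihilatorMap_octMul h0 hN, octConj_eq_zero, h0, hD]

theorem natCard_isCompletion_of_coord_zero_ne_zero [Fintype F] {D : Fin 8 → F} (h0 : D 0 ≠ 0)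
    (hN : octN D = 0) :
    Nat.card {t // IsCompletion D t} =
      (Fintype.card F ^ 4 - 1) * (Fintype.card F ^ 3 - 1) := by
  rw [← natCard_orthogonal_pairs_ne_zero]
  refine (Nat.card_eq_of_bijective
    (fun t => ⟨(rightAnnihilatorMap D t.1.1, leftAnnihilatorMap D t.1.2),
      (isCompletion_annihilatorMap_iff h0 hN _ _).mpr t.2⟩) ⟨?_, ?_⟩).symm
  · rintro ⟨⟨e, g⟩, _⟩ ⟨⟨e', g'⟩, _⟩ h
    simp only [Subtype.mk.injEq, Prod.mk.injEq] at h ⊢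
    constructor
    · rw [← rightAnnihilatorMap_coords D e, h.1, rightAnnihilatorMap_coords]
    · rw [← leftAnnihilatorMap_coords D g, h.2, leftAnnihilatorMap_coords]
  · rintro ⟨⟨E, G⟩, h⟩
    have hE := eq_rightAnnihilatorMap h0 h.2.2.1
    have hG := eq_leftAnnihilatorMap h0 h.2.2.2.2
    refine ⟨⟨(![E 0, E 1, E 2, E 3], ![G 4, -G 2, G 1, G 0]), ?_⟩, ?_⟩
    · rw [← isCompletion_annihilatorMap_iff h0 hN]
      simpa only [hE, hG] using h
    · simp only [hE, hG]

/-- Every nonzero singular octonion has the same number of completions. -/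
theorem natCard_isCompletion [Fintype F] {D : Fin 8 → F} (hD : D ≠ 0) (hN : octN D = 0) :
    Nat.card {t // IsCompletion D t} =
      (Fintype.card F ^ 4 - 1) * (Fintype.card F ^ 3 - 1) := by
  have key1 : ∀ {D : Fin 8 → F}, octN D = 0 → (D 0 ≠ 0 ∨ D 1 ≠ 0 ∨ D 2 ≠ 0 ∨ D 4 ≠ 0) →
      Nat.card {t // IsCompletion D t} =
        (Fintype.card F ^ 4 - 1) * (Fintype.card F ^ 3 - 1) := by
    intro D hN h
    have step : ∀ u : Fin 8 → F, octN u ≠ 0 → octMul u D 0 ≠ 0 →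
        Nat.card {t // IsCompletion D t} =
          (Fintype.card F ^ 4 - 1) * (Fintype.card F ^ 3 - 1) := by
      intro u hu h
      rw [← natCard_isCompletion_octMul hu]
      exact natCard_isCompletion_of_coord_zero_ne_zero h (by rw [octN_octMul, hN, mul_zero])
    rcases h with h | h | h | h
    · exact natCard_isCompletion_of_coord_zero_ne_zero h hN
    · exact step ![0, 0, 1, 0, 0, 1, 0, 0] (by simp [octN]) (by simpa [octMul] using h)
    · exact step ![0, 1, 0, 0, 0, 0, 1, 0] (by simp [octN]) (by simpa [octMul] using h)
    · exact step ![1, 0, 0, 0, 0, 0, 0, 1] (by simp [octN]) (by simpa [octMul] using h)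
  have key2 : ∀ {D : Fin 8 → F}, octN D = 0 →
      (D 0 ≠ 0 ∨ D 1 ≠ 0 ∨ D 2 ≠ 0 ∨ D 3 ≠ 0 ∨ D 4 ≠ 0) →
      Nat.card {t // IsCompletion D t} =
        (Fintype.card F ^ 4 - 1) * (Fintype.card F ^ 3 - 1) := by
    intro D hN h
    by_cases h3 : D 3 = 0
    · exact key1 hN (by tauto)
    · rw [← natCard_isCompletion_octConj]
      exact key1 (by rw [octN_octConj, hN]) (by simp [octConj, h3])
  by_cases h : D 0 ≠ 0 ∨ D 1 ≠ 0 ∨ D 2 ≠ 0 ∨ D 3 ≠ 0 ∨ D 4 ≠ 0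
  · exact key2 hN h
  push Not at h
  obtain ⟨h0, h1, h2, h3, h4⟩ := h
  have hu : octN (![1, 0, 0, 0, 0, 0, 0, 1] : Fin 8 → F) ≠ 0 := by simp [octN]
  rw [← natCard_isCompletion_octMul hu]
  refine key2 (by rw [octN_octMul, hN, mul_zero]) ?_
  contrapose! hD
  simp [octMul, h0, h1, h2, h3, h4] at hD
  ext i
  fin_cases i <;> simp [*]

/-- The number of nonzero singular octonions whose last coordinate vanishes. -/
theorem natCard_singular_octonions [Fintype F] :
    Nat.card {D : Fin 8 → F // D ≠ 0 ∧ octN D = 0 ∧ D 7 = 0} =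
      Fintype.card F ^ 6 - Fintype.card F ^ 3 + Fintype.card F ^ 4 - 1 := by
  rw [natCard_ne_zero_and (V := Fin 8 → F) (fun D => octN D = 0 ∧ D 7 = 0) (by simp [octN])]
  congr 1
  let e : {D : Fin 8 → F // octN D = 0 ∧ D 7 = 0} ≃
      F × {t : (Fin 3 → F) × (Fin 3 → F) // t.1 ⬝ᵥ t.2 = 0} :=
    { toFun := fun D => (D.1 0, ⟨(![D.1 1, D.1 2, D.1 3], ![D.1 6, D.1 5, D.1 4]), by
        have h := D.2.1
        simp only [octN, D.2.2] at h
        simp [dotProduct, Fin.sum_univ_succ]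
        linear_combination h⟩)
      invFun := fun s => ⟨![s.1, s.2.1.1 0, s.2.1.1 1, s.2.1.1 2, s.2.1.2 2, s.2.1.2 1,
        s.2.1.2 0, 0], by
        have h := s.2.2
        simp [dotProduct, Fin.sum_univ_succ] at h
        refine ⟨?_, rfl⟩
        simp [octN]
        linear_combination h⟩
      left_inv := by
        rintro ⟨D, h⟩
        ext i
        fin_cases i <;> simp [h.2]
      right_inv := by
        rintro ⟨x, ⟨⟨a, b⟩, h⟩⟩
        ext i
        · rfl
        · fin_cases i <;> rfl
        · fin_cases i <;> rfl }
  rw [Nat.card_congr e, Nat.card_prod, natCard_orthogonal_pairs, Nat.card_eq_fintype_card]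
  have h3 : 1 ≤ Fintype.card F ^ 3 := Nat.one_le_pow _ _ Fintype.card_pos
  have h6 : Fintype.card F ^ 3 ≤ Fintype.card F ^ 6 :=
    Nat.pow_le_pow_right Fintype.card_pos (by norm_num)
  zify [h3, h6]
  ring

end Octonion

/-- The number of triples `(D, E, F)` of nonzero octonions with
`DE = EF = FD = 0` and `Tr(x_1·D̄) = 0` equals
`(q^6 − q^3 + q^4 − 1)(q^4 − 1)(q^3 − 1)`. -/
theorem stmt_11 {F : Type*} [Field F] [Fintype F] :
    Nat.card {t : (Fin 8 → F) × (Fin 8 → F) × (Fin 8 → F) //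
        t.1 ≠ 0 ∧ t.2.1 ≠ 0 ∧ t.2.2 ≠ 0 ∧
        octMul t.1 t.2.1 = 0 ∧ octMul t.2.1 t.2.2 = 0 ∧ octMul t.2.2 t.1 = 0 ∧
        octTr (octMul octX1 (octConj t.1)) = 0} =
      (Fintype.card F ^ 6 - Fintype.card F ^ 3 + Fintype.card F ^ 4 - 1) *
        (Fintype.card F ^ 4 - 1) * (Fintype.card F ^ 3 - 1) := by
  rw [mul_assoc, ← natCard_singular_octonions,
    ← natCard_prod_of_fiber (r := IsCompletion) fun D hD => natCard_isCompletion hD.1 hD.2.1]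
  refine Nat.card_congr (Equiv.subtypeEquivRight ?_)
  rintro ⟨D, E, G⟩
  have htr : octTr (octMul octX1 (octConj D)) = D 7 := by
    simp [octTr, octMul, octX1, octConj]
  simp only [htr, IsCompletion]
  constructor
  · rintro ⟨hD, hE, hG, hDE, hEG, hGD, h7⟩
    exact ⟨⟨hD, octN_eq_zero_of_octMul_eq_zero hE hDE, h7⟩, hE, hG, hDE, hEG, hGD⟩
  · rintro ⟨⟨hD, -, h7⟩, hE, hG, hDE, hEG, hGD⟩
    exact ⟨hD, hE, hG, hDE, hEG, hGD, h7⟩
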